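/- arXiv:2203.06031 — 2 statements merged into one kernel-verified Lean document; each statement's English description precedes it below -/
import Mathlib

section
/- Let f : ℝ^n → ℝ be a differentiable convex function whose gradient is H-Lipschitz (H > 0), let 0 < η < 2/H, and let the sequence (w_t) be defined by gradient descent w_{t+1} = w_t - η·∇f(w_t) from an initial point w_0. If w* is a point with f(w*) ≤ f(w_t) for every t (e.g. a global minimizer of f), then for every T ≥ 1, the sum over t = 0, …, T-1 of ‖∇f(w_t)‖² is at most (2/(η(2 - H·η))) · (f(w_0) - f(w*)). -/
/-- The descent lemma: a differentiable function with `H`-Lipschitz gradient lies below its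
quadratic upper model at every point. -/
theorem le_add_inner_gradient_add_sq_of_lipschitz {E : Type*} [NormedAddCommGroup E]
    [InnerProductSpace ℝ E] [CompleteSpace E] {f : E → ℝ} (hdiff : Differentiable ℝ f) {H : ℝ}
    (hlip : ∀ x y, ‖gradient f x - gradient f y‖ ≤ H * ‖x - y‖) (x v : E) :
    f (x + v) ≤ f x + inner ℝ (gradient f x) v + H / 2 * ‖v‖ ^ 2 := by
  have hφ : ∀ t : ℝ, HasDerivAt (fun s : ℝ => f (x + s • v))
      (inner ℝ (gradient f (x + t • v)) v) t := fun t => by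
    have hline : HasDerivAt (fun s : ℝ => x + s • v) v t := by
      simpa using ((hasDerivAt_id t).smul_const v).const_add x
    simpa [Function.comp_def] using
      (hdiff (x + t • v)).hasGradientAt.hasFDerivAt.comp_hasDerivAt t hline
  have hB : ∀ t : ℝ, HasDerivAt
      (fun s : ℝ => f x + s * inner ℝ (gradient f x) v + H / 2 * ‖v‖ ^ 2 * s ^ 2)
      (inner ℝ (gradient f x) v + H * t * ‖v‖ ^ 2) t := fun t => by
    refine ((((hasDerivAt_id t).mul_const (inner ℝ (gradient f x) v)).const_add (f x)).add
      ((hasDerivAt_pow 2 t).const_mul (H / 2 * ‖v‖ ^ 2))).congr_deriv ?_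
    push_cast
    ring
  have key := image_le_of_deriv_right_le_deriv_boundary (a := 0) (b := 1)
    (fun t _ => (hφ t).continuousAt.continuousWithinAt)
    (fun t _ => (hφ t).hasDerivWithinAt) (by simp)
    (fun t _ => (hB t).continuousAt.continuousWithinAt)
    (fun t _ => (hB t).hasDerivWithinAt) (fun t ht => ?_)
    (Set.right_mem_Icc.2 zero_le_one)
  · simpa using key
  · have hgrad : ‖gradient f (x + t • v) - gradient f x‖ ≤ H * (t * ‖v‖) := by
      simpa [norm_smul, abs_of_nonneg ht.1] using hlip (x + t • v) x
    have hinner := (real_inner_le_norm (gradient f (x + t • v) - gradient f x) v).trans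
      (mul_le_mul_of_nonneg_right hgrad (norm_nonneg v))
    rw [inner_sub_left] at hinner
    linarith

/-- The decrease in value guaranteed by one gradient step of length `η`. -/
theorem mul_sq_norm_gradient_le_sub_of_lipschitz {E : Type*} [NormedAddCommGroup E]
    [InnerProductSpace ℝ E] [CompleteSpace E] {f : E → ℝ} (hdiff : Differentiable ℝ f) {H : ℝ}
    (hlip : ∀ x y, ‖gradient f x - gradient f y‖ ≤ H * ‖x - y‖) (η : ℝ) (x : E) :
    η * (2 - H * η) / 2 * ‖gradient f x‖ ^ 2 ≤ f x - f (x - η • gradient f x) := by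
  have h := le_add_inner_gradient_add_sq_of_lipschitz hdiff hlip x (-(η • gradient f x))
  rw [← sub_eq_add_neg, inner_neg_right, real_inner_smul_right, real_inner_self_eq_norm_sq,
    norm_neg, norm_smul, mul_pow, Real.norm_eq_abs, sq_abs] at h
  linarith

/-- Along gradient descent with step `0 < η < 2/H` on a differentiable convex
function with `H`-Lipschitz gradient, if `f(w*) ≤ f(w_t)` for all `t`, then
`∑_{t=0}^{T-1} ‖∇f(w_t)‖² ≤ (2/(η(2 - Hη))) (f(w_0) - f(w*))`. -/
theorem gradient_descent_sum_sq_norm_le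
    (n : ℕ) (f : EuclideanSpace ℝ (Fin n) → ℝ)
    (hdiff : Differentiable ℝ f)
    (hconv : ConvexOn ℝ Set.univ f)
    (H : ℝ) (hH : 0 < H)
    (hlip : ∀ x y, ‖gradient f x - gradient f y‖ ≤ H * ‖x - y‖)
    (η : ℝ) (hη₀ : 0 < η) (hη₁ : η < 2 / H)
    (w : ℕ → EuclideanSpace ℝ (Fin n))
    (hw : ∀ t, w (t + 1) = w t - η • gradient f (w t))
    (wstar : EuclideanSpace ℝ (Fin n))
    (hstar : ∀ t, f wstar ≤ f (w t))
    (T : ℕ) (hT : 1 ≤ T) :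
    ∑ t ∈ Finset.range T, ‖gradient f (w t)‖ ^ 2
      ≤ 2 / (η * (2 - H * η)) * (f (w 0) - f wstar) := by
  have hc : 0 < η * (2 - H * η) := by
    have := (lt_div_iff₀ hH).1 hη₁
    exact mul_pos hη₀ (by linarith)
  have hsum : η * (2 - H * η) / 2 * ∑ t ∈ Finset.range T, ‖gradient f (w t)‖ ^ 2
      ≤ f (w 0) - f wstar := by
    calc η * (2 - H * η) / 2 * ∑ t ∈ Finset.range T, ‖gradient f (w t)‖ ^ 2
        ≤ ∑ t ∈ Finset.range T, (f (w t) - f (w (t + 1))) := by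
          rw [Finset.mul_sum]
          refine Finset.sum_le_sum fun t _ => ?_
          rw [hw t]
          exact mul_sq_norm_gradient_le_sub_of_lipschitz hdiff hlip η (w t)
      _ = f (w 0) - f (w T) := Finset.sum_range_sub' (fun t => f (w t)) T
      _ ≤ f (w 0) - f wstar := sub_le_sub_left (hstar T) _
  rw [div_mul_eq_mul_div, le_div_iff₀ hc]
  linarith
end

section
/- (Theorem 1, max bound.) Let f : ℝ^n → ℝ be a differentiable convex function whose gradient is H-Lipschitz (H > 0), let 0 < η < 2/H, and let w_{t+1} = w_t - η·∇f(w_t) be the gradient-descent sequence from w_0. If w* satisfies f(w*) ≤ f(w_t) for every t, then for every T ≥ 1, max over t ∈ {0, …, T-1} of ‖∇f(w_t)‖² is at most (2/(η(2 - H·η))) · (f(w_0) - f(w*)). -/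
open scoped RealInnerProductSpace

/-- The descent lemma: a differentiable function with `H`-Lipschitz gradient is bounded above by
its quadratic model. -/
theorem le_add_inner_gradient_add_sq_norm {E : Type*} [NormedAddCommGroup E]
    [InnerProductSpace ℝ E] [CompleteSpace E] {f : E → ℝ} (hf : Differentiable ℝ f) {H : ℝ}
    (hlip : ∀ x y, ‖gradient f x - gradient f y‖ ≤ H * ‖x - y‖) (x v : E) :
    f (x + v) ≤ f x + ⟪gradient f x, v⟫ + H / 2 * ‖v‖ ^ 2 := by
  have hφ (s : ℝ) : HasDerivAt (fun s : ℝ => f (x + s • v)) ⟪gradient f (x + s • v), v⟫ s := by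
    have hline : HasDerivAt (fun s : ℝ => x + s • v) v s := by
      simpa using ((hasDerivAt_id s).smul_const v).const_add x
    simpa [Function.comp_def] using
      (hf (x + s • v)).hasGradientAt.hasFDerivAt.comp_hasDerivAt s hline
  have hB (s : ℝ) : HasDerivAt
      (fun s : ℝ => f x + s * ⟪gradient f x, v⟫ + H / 2 * ‖v‖ ^ 2 * s ^ 2)
      (⟪gradient f x, v⟫ + H * s * ‖v‖ ^ 2) s := by
    have h := (((hasDerivAt_id' s).mul_const ⟪gradient f x, v⟫).const_add (f x)).add
      ((hasDerivAt_pow 2 s).const_mul (H / 2 * ‖v‖ ^ 2))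
    exact h.congr_deriv (by norm_num; ring)
  have hle := image_le_of_deriv_right_le_deriv_boundary (a := 0) (b := 1)
    (fun s _ => (hφ s).continuousAt.continuousWithinAt)
    (fun s _ => (hφ s).hasDerivWithinAt) (by simp)
    (fun s _ => (hB s).continuousAt.continuousWithinAt)
    (fun s _ => (hB s).hasDerivWithinAt) (fun s hs => ?_)
    (Set.right_mem_Icc.2 zero_le_one)
  · simpa using hle
  · have hg : ‖gradient f (x + s • v) - gradient f x‖ ≤ H * (s * ‖v‖) := by
      simpa [norm_smul, abs_of_nonneg hs.1] using hlip (x + s • v) x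
    have hinner := (real_inner_le_norm (gradient f (x + s • v) - gradient f x) v).trans
      (mul_le_mul_of_nonneg_right hg (norm_nonneg v))
    rw [inner_sub_left] at hinner
    linarith

/-- The decrease of a function with `H`-Lipschitz gradient in one gradient-descent step. -/
theorem gradient_step_le {E : Type*} [NormedAddCommGroup E]
    [InnerProductSpace ℝ E] [CompleteSpace E] {f : E → ℝ} (hf : Differentiable ℝ f) {H : ℝ}
    (hlip : ∀ x y, ‖gradient f x - gradient f y‖ ≤ H * ‖x - y‖) (η : ℝ) (x : E) :
    f (x - η • gradient f x) ≤ f x - η * (2 - H * η) / 2 * ‖gradient f x‖ ^ 2 := by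
  have h := le_add_inner_gradient_add_sq_norm hf hlip x (-(η • gradient f x))
  rw [← sub_eq_add_neg, inner_neg_right, real_inner_smul_right, real_inner_self_eq_norm_sq,
    norm_neg, norm_smul, mul_pow, Real.norm_eq_abs, sq_abs] at h
  linarith


/-- Theorem 1 (max bound): along gradient descent with step `0 < η < 2/H` on a
differentiable convex function with `H`-Lipschitz gradient, if `f(w*) ≤ f(w_t)`
for all `t`, then `max_{t < T} ‖∇f(w_t)‖² ≤ (2/(η(2 - Hη))) (f(w_0) - f(w*))`. -/
theorem gradient_descent_max_sq_norm_le
    (n : ℕ) (f : EuclideanSpace ℝ (Fin n) → ℝ)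
    (hdiff : Differentiable ℝ f)
    (hconv : ConvexOn ℝ Set.univ f)
    (H : ℝ) (hH : 0 < H)
    (hlip : ∀ x y, ‖gradient f x - gradient f y‖ ≤ H * ‖x - y‖)
    (η : ℝ) (hη₀ : 0 < η) (hη₁ : η < 2 / H)
    (w : ℕ → EuclideanSpace ℝ (Fin n))
    (hw : ∀ t, w (t + 1) = w t - η • gradient f (w t))
    (wstar : EuclideanSpace ℝ (Fin n))
    (hstar : ∀ t, f wstar ≤ f (w t))
    (T : ℕ) (hT : 1 ≤ T) :
    (Finset.range T).sup' (Finset.nonempty_range_iff.mpr (by omega))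
        (fun t => ‖gradient f (w t)‖ ^ 2)
      ≤ 2 / (η * (2 - H * η)) * (f (w 0) - f wstar) := by
  have hstep (t : ℕ) := gradient_step_le hdiff hlip η (w t)
  simp only [← hw] at hstep
  have hpos : 0 < η * (2 - H * η) :=
    mul_pos hη₀ (by rw [lt_div_iff₀ hH] at hη₁; linarith)
  have hanti : Antitone (fun t => f (w t)) := antitone_nat_of_succ_le fun t =>
    (hstep t).trans (sub_le_self _ (by positivity))
  refine Finset.sup'_le _ _ fun t _ => ?_
  rw [div_mul_eq_mul_div, le_div_iff₀ hpos]
  linarith [hstep t, hstar (t + 1), hanti (Nat.zero_le t)]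
end
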